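/- Indifference for the call-by-value-to-call-by-name encoding: (1) for every term M and every value V, if M →ℓ∪β* V then (M~) λx.x →ℓ∪β* Ψ(V); (2) for every fragment S of the call-by-value calculus with algebraic equality such that (M~) λx.x ∈ S for all M ∈ S, and for every M ∈ S and value V, if M (=ℓ∪β^S)* V then (M~) λx.x (=ℓ∪β^S)* Ψ(V). (Here R* denotes the reflexive-transitive closure of a relation R.) -/

import Mathlib

namespace AlgLam

/-- Terms of the algebraic λ-calculus over a ring of scalars `R`,
    in de Bruijn representation. -/
inductive Term (R : Type u) : Type u
  | var : ℕ → Term R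
  | lam : Term R → Term R
  | app : Term R → Term R → Term R
  | zero : Term R
  | smul : R → Term R → Term R
  | add : Term R → Term R → Term R

namespace Term

variable {R : Type u}

/-- De Bruijn lifting: shift the free indices `≥ d` up by one. -/
def lift (d : ℕ) : Term R → Term R
  | var n => if n < d then var n else var (n + 1)
  | lam M => lam (lift (d + 1) M)
  | app M N => app (lift d M) (lift d N)
  | zero => zero
  | smul a M => smul a (lift d M)
  | add M N => add (lift d M) (lift d N)

/-- Capture-avoiding substitution of `N` for the free de Bruijn index `d`. -/
def subst (d : ℕ) (N : Term R) : Term R → Term R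
  | var n => if n < d then var n else if n = d then N else var (n - 1)
  | lam M => lam (subst (d + 1) (lift 0 N) M)
  | app M L => app (subst d N M) (subst d N L)
  | zero => zero
  | smul a M => smul a (subst d N M)
  | add M L => add (subst d N M) (subst d N L)

/-- Base terms: variables and λ-abstractions. -/
inductive IsBase : Term R → Prop
  | var (n : ℕ) : IsBase (var n)
  | lam (M : Term R) : IsBase (lam M)

/-- Values: `0`, base terms, scalar multiples of values, sums of values. -/
inductive IsValue : Term R → Prop
  | zero : IsValue zero
  | base {B : Term R} : IsBase B → IsValue B
  | smul (a : R) {V : Term R} : IsValue V → IsValue (smul a V)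
  | add {V W : Term R} : IsValue V → IsValue W → IsValue (add V W)

/-- `ClosedUnder d M` : every free index of `M` is `< d`. -/
def ClosedUnder : ℕ → Term R → Prop
  | d, var n => n < d
  | d, lam M => ClosedUnder (d + 1) M
  | d, app M N => ClosedUnder d M ∧ ClosedUnder d N
  | _, zero => True
  | d, smul _ M => ClosedUnder d M
  | d, add M N => ClosedUnder d M ∧ ClosedUnder d N

/-- A closed term (a program). -/
def Closed (M : Term R) : Prop := ClosedUnder 0 M

section Rules

variable [CommRing R]

/-- The rewrite relation `→a` of the call-by-name algebraic λ-calculus: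
    ring rules and call-by-name application rules, closed under the ξ contexts. -/
inductive StepA : Term R → Term R → Prop
  -- ring rules
  | assocL (M N L : Term R) : StepA (add M (add N L)) (add (add M N) L)
  | assocR (M N L : Term R) : StepA (add (add M N) L) (add M (add N L))
  | comm (M N : Term R) : StepA (add M N) (add N M)
  | factor (a b : R) (M : Term R) : StepA (add (smul a M) (smul b M)) (smul (a + b) M)
  | factor1 (a : R) (M : Term R) : StepA (add (smul a M) M) (smul (a + 1) M)
  | factor11 (M : Term R) : StepA (add M M) (smul (1 + 1) M)
  | mulMul (a b : R) (M : Term R) : StepA (smul a (smul b M)) (smul (a * b) M)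
  | mulDist (a : R) (M N : Term R) : StepA (smul a (add M N)) (add (smul a M) (smul a N))
  | oneSmul (M : Term R) : StepA (smul 1 M) M
  | zeroSmul (M : Term R) : StepA (smul 0 M) zero
  | smulZero (a : R) : StepA (smul a zero) zero
  | zeroAdd (M : Term R) : StepA (add zero M) M
  -- call-by-name application rules (A)
  | appAdd (M N L : Term R) : StepA (app (add M N) L) (add (app M L) (app N L))
  | appSmul (a : R) (M N : Term R) : StepA (app (smul a M) N) (smul a (app M N))
  | appZero (M : Term R) : StepA (app zero M) zero
  -- ξ context rules
  | ctxAppL {M M' : Term R} (N : Term R) : StepA M M' → StepA (app M N) (app M' N)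
  | ctxAddL {M M' : Term R} (N : Term R) : StepA M M' → StepA (add M N) (add M' N)
  | ctxAddR {N N' : Term R} (M : Term R) : StepA N N' → StepA (add M N) (add M N')
  | ctxSmul (a : R) {M M' : Term R} : StepA M M' → StepA (smul a M) (smul a M')

/-- The call-by-name β-reduction `→βn`, closed under the ξ contexts. -/
inductive StepBn : Term R → Term R → Prop
  | beta (M N : Term R) : StepBn (app (lam M) N) (subst 0 N M)
  | ctxAppL {M M' : Term R} (N : Term R) : StepBn M M' → StepBn (app M N) (app M' N)
  | ctxAddL {M M' : Term R} (N : Term R) : StepBn M M' → StepBn (add M N) (add M' N)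
  | ctxAddR {N N' : Term R} (M : Term R) : StepBn N N' → StepBn (add M N) (add M N')
  | ctxSmul (a : R) {M M' : Term R} : StepBn M M' → StepBn (smul a M) (smul a M')

/-- The rewrite relation `→a∪β`. -/
def StepAB (M N : Term R) : Prop := StepA M N ∨ StepBn M N

/-- The rewrite relation `→ℓ` of the call-by-value algebraic λ-calculus:
    ring rules, left- and right-linearity rules, closed under ξ and ξ_lin. -/
inductive StepL : Term R → Term R → Prop
  -- ring rules
  | assocL (M N L : Term R) : StepL (add M (add N L)) (add (add M N) L)
  | assocR (M N L : Term R) : StepL (add (add M N) L) (add M (add N L))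
  | comm (M N : Term R) : StepL (add M N) (add N M)
  | factor (a b : R) (M : Term R) : StepL (add (smul a M) (smul b M)) (smul (a + b) M)
  | factor1 (a : R) (M : Term R) : StepL (add (smul a M) M) (smul (a + 1) M)
  | factor11 (M : Term R) : StepL (add M M) (smul (1 + 1) M)
  | mulMul (a b : R) (M : Term R) : StepL (smul a (smul b M)) (smul (a * b) M)
  | mulDist (a : R) (M N : Term R) : StepL (smul a (add M N)) (add (smul a M) (smul a N))
  | oneSmul (M : Term R) : StepL (smul 1 M) M
  | zeroSmul (M : Term R) : StepL (smul 0 M) zero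
  | smulZero (a : R) : StepL (smul a zero) zero
  | zeroAdd (M : Term R) : StepL (add zero M) M
  -- left linearity (A_l), the argument must be a value
  | appAddV {V : Term R} (M N : Term R) : IsValue V →
      StepL (app (add M N) V) (add (app M V) (app N V))
  | appSmulV {V : Term R} (a : R) (M : Term R) : IsValue V →
      StepL (app (smul a M) V) (smul a (app M V))
  | appZeroV {V : Term R} : IsValue V → StepL (app zero V) zero
  -- right linearity (A_r), the function must be a base term
  | appAddB {B : Term R} (M N : Term R) : IsBase B →
      StepL (app B (add M N)) (add (app B M) (app B N))
  | appSmulB {B : Term R} (a : R) (M : Term R) : IsBase B →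
      StepL (app B (smul a M)) (smul a (app B M))
  | appZeroB {B : Term R} : IsBase B → StepL (app B zero) zero
  -- ξ context rules
  | ctxAppL {M M' : Term R} (N : Term R) : StepL M M' → StepL (app M N) (app M' N)
  | ctxAddL {M M' : Term R} (N : Term R) : StepL M M' → StepL (add M N) (add M' N)
  | ctxAddR {N N' : Term R} (M : Term R) : StepL N N' → StepL (add M N) (add M N')
  | ctxSmul (a : R) {M M' : Term R} : StepL M M' → StepL (smul a M) (smul a M')
  -- ξ_lin context rule
  | ctxAppR {V M M' : Term R} : IsValue V → StepL M M' → StepL (app V M) (app V M')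

/-- The call-by-value β-reduction `→βv`, closed under ξ and ξ_lin. -/
inductive StepBv : Term R → Term R → Prop
  | beta (M : Term R) {B : Term R} : IsBase B → StepBv (app (lam M) B) (subst 0 B M)
  | ctxAppL {M M' : Term R} (N : Term R) : StepBv M M' → StepBv (app M N) (app M' N)
  | ctxAddL {M M' : Term R} (N : Term R) : StepBv M M' → StepBv (add M N) (add M' N)
  | ctxAddR {N N' : Term R} (M : Term R) : StepBv N N' → StepBv (add M N) (add M N')
  | ctxSmul (a : R) {M M' : Term R} : StepBv M M' → StepBv (smul a M) (smul a M')
  | ctxAppR {V M M' : Term R} : IsValue V → StepBv M M' → StepBv (app V M) (app V M')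

/-- The rewrite relation `→ℓ∪β`. -/
def StepLB (M N : Term R) : Prop := StepL M N ∨ StepBv M N

end Rules

/-- Steps of `→a` performed by an associativity or commutativity rule
    (closed under the ξ contexts). -/
inductive StepACa : Term R → Term R → Prop
  | assocL (M N L : Term R) : StepACa (add M (add N L)) (add (add M N) L)
  | assocR (M N L : Term R) : StepACa (add (add M N) L) (add M (add N L))
  | comm (M N : Term R) : StepACa (add M N) (add N M)
  | ctxAppL {M M' : Term R} (N : Term R) : StepACa M M' → StepACa (app M N) (app M' N)
  | ctxAddL {M M' : Term R} (N : Term R) : StepACa M M' → StepACa (add M N) (add M' N)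
  | ctxAddR {N N' : Term R} (M : Term R) : StepACa N N' → StepACa (add M N) (add M N')
  | ctxSmul (a : R) {M M' : Term R} : StepACa M M' → StepACa (smul a M) (smul a M')

/-- Steps of `→ℓ` performed by an associativity or commutativity rule
    (closed under the ξ and ξ_lin contexts). -/
inductive StepACl : Term R → Term R → Prop
  | assocL (M N L : Term R) : StepACl (add M (add N L)) (add (add M N) L)
  | assocR (M N L : Term R) : StepACl (add (add M N) L) (add M (add N L))
  | comm (M N : Term R) : StepACl (add M N) (add N M)
  | ctxAppL {M M' : Term R} (N : Term R) : StepACl M M' → StepACl (app M N) (app M' N)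
  | ctxAddL {M M' : Term R} (N : Term R) : StepACl M M' → StepACl (add M N) (add M' N)
  | ctxAddR {N N' : Term R} (M : Term R) : StepACl N N' → StepACl (add M N) (add M N')
  | ctxSmul (a : R) {M M' : Term R} : StepACl M M' → StepACl (smul a M) (smul a M')
  | ctxAppR {V M M' : Term R} : IsValue V → StepACl M M' → StepACl (app V M) (app V M')

section NonAC

variable [CommRing R]

/-- Steps of `→a` performed by a rule other than associativity or commutativity of `+`
    (closed under the ξ contexts). -/
inductive StepNAa : Term R → Term R → Prop
  | factor (a b : R) (M : Term R) : StepNAa (add (smul a M) (smul b M)) (smul (a + b) M)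
  | factor1 (a : R) (M : Term R) : StepNAa (add (smul a M) M) (smul (a + 1) M)
  | factor11 (M : Term R) : StepNAa (add M M) (smul (1 + 1) M)
  | mulMul (a b : R) (M : Term R) : StepNAa (smul a (smul b M)) (smul (a * b) M)
  | mulDist (a : R) (M N : Term R) : StepNAa (smul a (add M N)) (add (smul a M) (smul a N))
  | oneSmul (M : Term R) : StepNAa (smul 1 M) M
  | zeroSmul (M : Term R) : StepNAa (smul 0 M) zero
  | smulZero (a : R) : StepNAa (smul a zero) zero
  | zeroAdd (M : Term R) : StepNAa (add zero M) M
  | appAdd (M N L : Term R) : StepNAa (app (add M N) L) (add (app M L) (app N L))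
  | appSmul (a : R) (M N : Term R) : StepNAa (app (smul a M) N) (smul a (app M N))
  | appZero (M : Term R) : StepNAa (app zero M) zero
  | ctxAppL {M M' : Term R} (N : Term R) : StepNAa M M' → StepNAa (app M N) (app M' N)
  | ctxAddL {M M' : Term R} (N : Term R) : StepNAa M M' → StepNAa (add M N) (add M' N)
  | ctxAddR {N N' : Term R} (M : Term R) : StepNAa N N' → StepNAa (add M N) (add M N')
  | ctxSmul (a : R) {M M' : Term R} : StepNAa M M' → StepNAa (smul a M) (smul a M')

/-- Steps of `→ℓ` performed by a rule other than associativity or commutativity of `+`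
    (closed under the ξ and ξ_lin contexts). -/
inductive StepNAl : Term R → Term R → Prop
  | factor (a b : R) (M : Term R) : StepNAl (add (smul a M) (smul b M)) (smul (a + b) M)
  | factor1 (a : R) (M : Term R) : StepNAl (add (smul a M) M) (smul (a + 1) M)
  | factor11 (M : Term R) : StepNAl (add M M) (smul (1 + 1) M)
  | mulMul (a b : R) (M : Term R) : StepNAl (smul a (smul b M)) (smul (a * b) M)
  | mulDist (a : R) (M N : Term R) : StepNAl (smul a (add M N)) (add (smul a M) (smul a N))
  | oneSmul (M : Term R) : StepNAl (smul 1 M) M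
  | zeroSmul (M : Term R) : StepNAl (smul 0 M) zero
  | smulZero (a : R) : StepNAl (smul a zero) zero
  | zeroAdd (M : Term R) : StepNAl (add zero M) M
  | appAddV {V : Term R} (M N : Term R) : IsValue V →
      StepNAl (app (add M N) V) (add (app M V) (app N V))
  | appSmulV {V : Term R} (a : R) (M : Term R) : IsValue V →
      StepNAl (app (smul a M) V) (smul a (app M V))
  | appZeroV {V : Term R} : IsValue V → StepNAl (app zero V) zero
  | appAddB {B : Term R} (M N : Term R) : IsBase B →
      StepNAl (app B (add M N)) (add (app B M) (app B N))
  | appSmulB {B : Term R} (a : R) (M : Term R) : IsBase B →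
      StepNAl (app B (smul a M)) (smul a (app B M))
  | appZeroB {B : Term R} : IsBase B → StepNAl (app B zero) zero
  | ctxAppL {M M' : Term R} (N : Term R) : StepNAl M M' → StepNAl (app M N) (app M' N)
  | ctxAddL {M M' : Term R} (N : Term R) : StepNAl M M' → StepNAl (add M N) (add M' N)
  | ctxAddR {N N' : Term R} (M : Term R) : StepNAl N N' → StepNAl (add M N) (add M N')
  | ctxSmul (a : R) {M M' : Term R} : StepNAl M M' → StepNAl (smul a M) (smul a M')
  | ctxAppR {V M M' : Term R} : IsValue V → StepNAl M M' → StepNAl (app V M) (app V M')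

end NonAC

/-- The call-by-value-to-call-by-name encoding `M ↦ M~`.
    The fresh variables `f`, `g`, `h` are handled by de Bruijn lifting. -/
def cbvEnc : Term R → Term R
  | var n => lam (app (var 0) (var (n + 1)))
  | zero => zero
  | lam M => lam (app (var 0) (lift 0 (lam (cbvEnc M))))
  | app M N =>
      lam (app (lift 0 (cbvEnc M))
        (lam (app (lift 0 (lift 0 (cbvEnc N)))
          (lam (app (app (var 1) (var 0)) (var 2))))))
  | smul a M => lam (app (smul a (lift 0 (cbvEnc M))) (var 0))
  | add M N => lam (app (add (lift 0 (cbvEnc M)) (lift 0 (cbvEnc N))) (var 0))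

/-- The value encoding `Ψ` (its value on non-values is irrelevant). -/
def psi : Term R → Term R
  | var n => var n
  | zero => zero
  | lam M => lam (cbvEnc M)
  | smul a V => smul a (psi V)
  | add V W => add (psi V) (psi W)
  | app M N => app (psi M) (psi N)

/-- The call-by-name-to-call-by-value encoding `M ↦ ⟦M⟧`. -/
def cbnEnc : Term R → Term R
  | var n => var n
  | zero => lam (app zero (var 0))
  | lam M => lam (app (var 0) (lift 0 (lam (cbnEnc M))))
  | app M N =>
      lam (app (lift 0 (cbnEnc M))
        (lam (app (app (var 0) (lift 0 (lift 0 (cbnEnc N)))) (var 1))))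
  | smul a M => lam (app (smul a (lift 0 (cbnEnc M))) (var 0))
  | add M N => lam (app (add (lift 0 (cbnEnc M)) (lift 0 (cbnEnc N))) (var 0))

/-- The value encoding `Φ` (its value on non-values is irrelevant). -/
def phi : Term R → Term R
  | var n => app (var n) (lam (var 0))
  | zero => zero
  | lam M => lam (cbnEnc M)
  | smul a V => smul a (phi V)
  | add V W => add (phi V) (phi W)
  | app M N => app (phi M) (phi N)

/-- A measure on terms used to define the administrative operation `(:)`. -/
def size : Term R → ℕ
  | var _ => 1
  | lam _ => 1
  | zero => 1
  | smul _ M => 1 + size M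
  | add M N => 1 + size M + size N
  | app M N => size M * (size N + 1)

theorem size_pos : ∀ M : Term R, 0 < size M
  | var _ => Nat.one_pos
  | lam _ => Nat.one_pos
  | zero => Nat.one_pos
  | smul _ M => by simp [size]
  | add M N => by simp [size]
  | app M N => Nat.mul_pos (size_pos M) (Nat.succ_pos _)

/-- The administrative infix operation `(:)` of the call-by-value to call-by-name
    simulation: `colon M K` is `M : K`. -/
def colon : Term R → Term R → Term R
  | zero, _ => zero
  | var n, K => app K (var n)
  | lam M, K => app K (lam (cbvEnc M))
  | smul a M, K => smul a (colon M K)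
  | add M N, K => add (colon M K) (colon N K)
  | app zero _, _ => zero
  | app (var n) N, K =>
      colon N (lam (app (app (var (n + 1)) (var 0)) (lift 0 K)))
  | app (lam M) N, K =>
      colon N (lam (app (app (lift 0 (lam (cbvEnc M))) (var 0)) (lift 0 K)))
  | app (smul a M) N, K => smul a (colon (app M N) K)
  | app (add M M') N, K => add (colon (app M N) K) (colon (app M' N) K)
  | app (app M M') L, K =>
      colon (app M M')
        (lam (app (lift 0 (cbvEnc L))
          (lam (app (app (var 1) (var 0)) (lift 0 (lift 0 K))))))
termination_by M _ => size M
decreasing_by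
  all_goals simp only [size]
  · omega
  · omega
  · omega
  · nlinarith [size_pos N]
  · nlinarith [size_pos N]
  · nlinarith [size_pos M, size_pos N]
  · nlinarith [size_pos M, size_pos M', size_pos N]
  · nlinarith [size_pos M, size_pos M', size_pos N]
  · nlinarith [size_pos L, Nat.mul_pos (size_pos M) (Nat.succ_pos (size M'))]



section Equalities

variable [CommRing R]

/-- The restricted algebraic equality `=ℓ^F` on a fragment `F`. -/
def EqL (F : Set (Term R)) (M N : Term R) : Prop :=
  M ∈ F ∧ N ∈ F ∧ (StepL M N ∨ StepL N M)

/-- The relation `=ℓ∪β^F` : restricted algebraic equality together with `→βv` restricted to `F`. -/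
def EqLB (F : Set (Term R)) (M N : Term R) : Prop :=
  EqL F M N ∨ (M ∈ F ∧ N ∈ F ∧ StepBv M N)

/-- The restricted algebraic equality `=a^F` on a fragment `F`. -/
def EqA (F : Set (Term R)) (M N : Term R) : Prop :=
  M ∈ F ∧ N ∈ F ∧ (StepA M N ∨ StepA N M)

/-- The relation `=a∪β^F` : restricted algebraic equality together with `→βn` restricted to `F`. -/
def EqAB (F : Set (Term R)) (M N : Term R) : Prop :=
  EqA F M N ∨ (M ∈ F ∧ N ∈ F ∧ StepBn M N)

/-- The unrestricted algebraic equality `=ℓ` (symmetric closure of `→ℓ`). -/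
def EqLfull (M N : Term R) : Prop := StepL M N ∨ StepL N M

/-- The unrestricted relation `=ℓ∪β`. -/
def EqLBfull (M N : Term R) : Prop := EqLfull M N ∨ StepBv M N

/-- The unrestricted algebraic equality `=a` (symmetric closure of `→a`). -/
def EqAfull (M N : Term R) : Prop := StepA M N ∨ StepA N M

/-- The unrestricted relation `=a∪β`. -/
def EqABfull (M N : Term R) : Prop := EqAfull M N ∨ StepBn M N

end Equalities

section Lifting

theorem lift_lift (M : Term R) : ∀ {i j : ℕ}, i ≤ j →
    lift i (lift j M) = lift (j + 1) (lift i M) := by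
  induction M with
  | var n =>
    intro i j h
    simp only [lift]
    split_ifs <;> simp only [lift] <;> split_ifs <;> first | rfl | omega
  | lam M ih => intro i j h; simp only [lift]; rw [ih (by omega)]
  | app M N ihM ihN => intro i j h; simp only [lift]; rw [ihM h, ihN h]
  | zero => intro i j h; rfl
  | smul a M ih => intro i j h; simp only [lift]; rw [ih h]
  | add M N ihM ihN => intro i j h; simp only [lift]; rw [ihM h, ihN h]

@[simp]
theorem subst_lift_self (M : Term R) : ∀ (d : ℕ) (N : Term R), subst d N (lift d M) = M := by
  induction M with
  | var n =>
    intro d N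
    simp only [lift]
    split_ifs <;> simp only [subst] <;> split_ifs <;> first | rfl | omega
  | lam M ih => intro d N; simp only [lift, subst, ih]
  | app M N ihM ihN => intro d N; simp only [lift, subst, ihM, ihN]
  | zero => intro d N; rfl
  | smul a M ih => intro d N; simp only [lift, subst, ih]
  | add M N ihM ihN => intro d N; simp only [lift, subst, ihM, ihN]

theorem subst_lift (M : Term R) : ∀ {i d : ℕ} (N : Term R), i ≤ d →
    subst (d + 1) (lift i N) (lift i M) = lift i (subst d N M) := by
  induction M with
  | var n =>
    intro i d N h
    simp only [lift, subst]
    split_ifs <;> simp only [lift, subst] <;> split_ifs <;>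
      first
        | rfl
        | omega
        | (congr 1; omega)
  | lam M ih =>
    intro i d N h
    simp only [lift, subst]
    rw [lift_lift N (Nat.zero_le i), ih _ (by omega)]
  | app M N ihM ihN => intro i d L h; simp only [lift, subst]; rw [ihM _ h, ihN _ h]
  | zero => intro i d N h; rfl
  | smul a M ih => intro i d N h; simp only [lift, subst]; rw [ih _ h]
  | add M N ihM ihN => intro i d L h; simp only [lift, subst]; rw [ihM _ h, ihN _ h]

@[simp]
theorem subst_one_lift_lift (M N : Term R) : subst 1 N (lift 0 (lift 0 M)) = lift 0 M := by
  rw [lift_lift M le_rfl, subst_lift_self]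

theorem IsBase.lift {B : Term R} (hB : IsBase B) (d : ℕ) : IsBase (lift d B) := by
  cases hB with
  | var n => simp only [Term.lift]; split_ifs <;> constructor
  | lam M => constructor

theorem cbvEnc_lift (M : Term R) : ∀ d : ℕ, cbvEnc (lift d M) = lift d (cbvEnc M) := by
  induction M with
  | var n =>
    intro d
    by_cases h : n < d <;> simp [lift, cbvEnc, h]
  | lam M ih => intro d; simp [lift, cbvEnc, ih, lift_lift _ (Nat.le_add_left 1 d)]
  | app M N ihM ihN =>
    intro d
    simp [lift, cbvEnc, ihM, ihN, lift_lift _ (Nat.zero_le _)]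
  | zero => intro d; rfl
  | smul a M ih => intro d; simp [lift, cbvEnc, ih, lift_lift _ (Nat.zero_le d)]
  | add M N ihM ihN => intro d; simp [lift, cbvEnc, ihM, ihN, lift_lift _ (Nat.zero_le d)]

theorem psi_lift {B : Term R} (hB : IsBase B) (d : ℕ) : psi (lift d B) = lift d (psi B) := by
  cases hB with
  | var n => simp only [lift, psi]; split_ifs <;> rfl
  | lam M => simp only [lift, psi, cbvEnc_lift]

theorem IsBase.psi {B : Term R} (hB : IsBase B) : IsBase (psi B) := by
  cases hB <;> constructor

/-- The encoding commutes with the substitution of a base term. -/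
theorem cbvEnc_subst (M : Term R) : ∀ (d : ℕ) {B : Term R}, IsBase B →
    cbvEnc (subst d B M) = subst d (psi B) (cbvEnc M) := by
  induction M with
  | var n =>
    intro d B hB
    rcases lt_trichotomy n d with h | rfl | h
    · simp [subst, cbvEnc, h]
    · cases hB <;> simp [subst, cbvEnc, psi, lift]
    · obtain ⟨n, rfl⟩ : ∃ k, n = k + 1 := ⟨n - 1, by omega⟩
      simp [subst, cbvEnc, show ¬ n + 1 < d by omega, show n + 1 ≠ d by omega]
  | lam M ih =>
    intro d B hB
    simp only [subst, cbvEnc, lift, ih _ (hB.lift 0), psi_lift hB]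
    rw [← subst_lift _ _ (Nat.le_add_left 1 d), ← lift_lift _ le_rfl]
    simp
  | app M N ihM ihN =>
    intro d B hB
    simp [subst, cbvEnc, ihM _ hB, ihN _ hB, ← subst_lift _ _ (Nat.zero_le _)]
  | zero => intro d B hB; rfl
  | smul a M ih =>
    intro d B hB
    simp [subst, cbvEnc, ih _ hB, ← subst_lift _ _ (Nat.zero_le _)]
  | add M N ihM ihN =>
    intro d B hB
    simp [subst, cbvEnc, ihM _ hB, ihN _ hB, ← subst_lift _ _ (Nat.zero_le _)]

end Lifting

section Simulation

open Relation

/-- The continuation evaluating the argument `N` of an application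
before returning the result to `K`. -/
def argCont (N K : Term R) : Term R :=
  lam (app (lift 0 (cbvEnc N)) (lam (app (app (var 1) (var 0)) (lift 0 (lift 0 K)))))

/-- The continuation applying the encoded base term `P` to its input
before returning the result to `K`. -/
def funCont (P K : Term R) : Term R :=
  lam (app (app (lift 0 P) (var 0)) (lift 0 K))

theorem colon_app_base {B : Term R} (hB : IsBase B) (N K : Term R) :
    colon (app B N) K = colon N (funCont (psi B) K) := by
  cases hB with
  | var n => rw [colon]; simp [funCont, psi, lift]
  | lam M => rw [colon]; simp [funCont, psi]

theorem colon_app_app (M M' L K : Term R) :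
    colon (app (app M M') L) K = colon (app M M') (argCont L K) := by
  rw [colon, argCont]

theorem colon_base {B : Term R} (hB : IsBase B) (K : Term R) :
    colon B K = app K (psi B) := by
  cases hB <;> rw [colon] <;> rfl

/-- A relation compatible with `add` and `smul` that relates the colon forms of `M` and `M'`
relates those of `app V M` and `app V M'` for every value `V`. -/
theorem colon_app_value_congr {r : Term R → Term R → Prop} (hr : ∀ M, r M M)
    (hadd : ∀ {M M' N N'}, r M M' → r N N' → r (add M N) (add M' N'))
    (hsmul : ∀ (a : R) {M M'}, r M M' → r (smul a M) (smul a M'))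
    {M M' K : Term R} (h : ∀ P, r (colon M (funCont P K)) (colon M' (funCont P K)))
    {V : Term R} (hV : IsValue V) : r (colon (app V M) K) (colon (app V M') K) := by
  induction hV with
  | zero => simp only [colon]; exact hr _
  | base hB => simpa only [colon_app_base hB] using h _
  | smul a _ ih => simp only [colon]; exact hsmul a ih
  | add _ _ ih₁ ih₂ => simp only [colon]; exact hadd ih₁ ih₂

variable [CommRing R]

theorem StepL.reflTransGen_add {M M' N N' : Term R} (hM : ReflTransGen StepL M M')
    (hN : ReflTransGen StepL N N') : ReflTransGen StepL (add M N) (add M' N') :=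
  (hM.lift (fun X => add X N) fun _ _ => .ctxAddL N).trans (hN.lift _ fun _ _ => .ctxAddR M')

theorem StepL.reflTransGen_smul (a : R) {M M' : Term R} (hM : ReflTransGen StepL M M') :
    ReflTransGen StepL (smul a M) (smul a M') :=
  hM.lift _ fun _ _ => .ctxSmul a

theorem StepLB.reflTransGen_add {M M' N N' : Term R} (hM : ReflTransGen StepLB M M')
    (hN : ReflTransGen StepLB N N') : ReflTransGen StepLB (add M N) (add M' N') :=
  (hM.lift (fun X => add X N) fun _ _ => Or.imp (.ctxAddL N) (.ctxAddL N)).trans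
    (hN.lift (add M') fun _ _ => Or.imp (.ctxAddR M') (.ctxAddR M'))

theorem StepLB.reflTransGen_smul (a : R) {M M' : Term R} (hM : ReflTransGen StepLB M M') :
    ReflTransGen StepLB (smul a M) (smul a M') :=
  hM.lift (smul a) fun _ _ => Or.imp (.ctxSmul a) (.ctxSmul a)

/-- Applying a sum to a base term in call-by-value distributes. -/
theorem reflTransGen_app_add {K : Term R} (hK : IsBase K) {M N X Y : Term R}
    (hM : ReflTransGen StepLB (app M K) X) (hN : ReflTransGen StepLB (app N K) Y) :
    ReflTransGen StepLB (app (add M N) K) (add X Y) :=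
  .head (.inl (.appAddV M N (.base hK))) (StepLB.reflTransGen_add hM hN)

theorem reflTransGen_app_smul {K : Term R} (hK : IsBase K) (a : R) {M X : Term R}
    (hM : ReflTransGen StepLB (app M K) X) :
    ReflTransGen StepLB (app (smul a M) K) (smul a X) :=
  .head (.inl (.appSmulV a M (.base hK))) (StepLB.reflTransGen_smul a hM)

theorem stepLB_beta {M B N : Term R} (hB : IsBase B) (h : subst 0 B M = N) :
    StepLB (app (lam M) B) N :=
  h ▸ .inr (.beta M hB)

theorem stepLB_cbvEnc_base {B K : Term R} (hB : IsBase B) (hK : IsBase K) :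
    StepLB (app (cbvEnc B) K) (app K (psi B)) := by
  cases hB with
  | var n => exact stepLB_beta hK (by simp [subst, psi])
  | lam M =>
    refine stepLB_beta hK ?_
    simp only [subst, subst_lift_self, psi, if_true, lt_irrefl, if_false]

theorem stepLB_argCont {B : Term R} (hB : IsBase B) (N K : Term R) :
    StepLB (app (argCont N K) (psi B)) (app (cbvEnc N) (funCont (psi B) K)) :=
  stepLB_beta hB.psi (by simp [subst, funCont])

theorem stepLB_cbvEnc_app (M N : Term R) {K : Term R} (hK : IsBase K) :
    StepLB (app (cbvEnc (app M N)) K) (app (cbvEnc M) (argCont N K)) :=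
  stepLB_beta hK (by simp [subst, argCont])

theorem stepLB_cbvEnc_smul (a : R) (M : Term R) {K : Term R} (hK : IsBase K) :
    StepLB (app (cbvEnc (smul a M)) K) (app (smul a (cbvEnc M)) K) :=
  stepLB_beta hK (by simp [subst])

theorem stepLB_cbvEnc_add (M N : Term R) {K : Term R} (hK : IsBase K) :
    StepLB (app (cbvEnc (add M N)) K) (app (add (cbvEnc M) (cbvEnc N)) K) :=
  stepLB_beta hK (by simp [subst])

theorem reflTransGen_cbvEnc_colon_aux (M : Term R) :
    (∀ K, IsBase K → ReflTransGen StepLB (app (cbvEnc M) K) (colon M K)) ∧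
    ∀ N, (∀ K, IsBase K → ReflTransGen StepLB (app (cbvEnc N) K) (colon N K)) →
      ∀ K, ReflTransGen StepLB (app (cbvEnc M) (argCont N K)) (colon (app M N) K) := by
  have base {B : Term R} (hB : IsBase B) :
      (∀ K, IsBase K → ReflTransGen StepLB (app (cbvEnc B) K) (colon B K)) ∧
      ∀ N, (∀ K, IsBase K → ReflTransGen StepLB (app (cbvEnc N) K) (colon N K)) →
        ∀ K, ReflTransGen StepLB (app (cbvEnc B) (argCont N K)) (colon (app B N) K) := by
    refine ⟨fun K hK => ?_, fun N hN K => ?_⟩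
    · rw [colon_base hB]
      exact .single (stepLB_cbvEnc_base hB hK)
    · rw [colon_app_base hB]
      exact .head (stepLB_cbvEnc_base hB (.lam _))
        (.head (stepLB_argCont hB N K) (hN _ (.lam _)))
  induction M with
  | var n => exact base (.var n)
  | lam M => exact base (.lam M)
  | app M M' ihM ihM' =>
    have h (K : Term R) (hK : IsBase K) :
        ReflTransGen StepLB (app (cbvEnc (app M M')) K) (colon (app M M') K) :=
      .head (stepLB_cbvEnc_app M M' hK) (ihM.2 M' ihM'.1 K)
    refine ⟨h, fun N _ K => ?_⟩
    rw [colon_app_app]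
    exact h _ (.lam _)
  | zero =>
    refine ⟨fun K hK => ?_, fun N _ K => ?_⟩ <;> rw [colon]
    · exact .single (.inl (.appZeroV (.base hK)))
    · exact .single (.inl (.appZeroV (.base (.lam _))))
  | smul a M ih =>
    refine ⟨fun K hK => ?_, fun N hN K => ?_⟩ <;> rw [colon]
    · exact .head (stepLB_cbvEnc_smul a M hK) (reflTransGen_app_smul hK a (ih.1 K hK))
    · exact .head (stepLB_cbvEnc_smul a M (.lam _))
        (reflTransGen_app_smul (.lam _) a (ih.2 N hN K))
  | add M M' ihM ihM' =>
    refine ⟨fun K hK => ?_, fun N hN K => ?_⟩ <;> rw [colon]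
    · exact .head (stepLB_cbvEnc_add M M' hK)
        (reflTransGen_app_add hK (ihM.1 K hK) (ihM'.1 K hK))
    · exact .head (stepLB_cbvEnc_add M M' (.lam _))
        (reflTransGen_app_add (.lam _) (ihM.2 N hN K) (ihM'.2 N hN K))

theorem reflTransGen_cbvEnc_colon (M : Term R) {K : Term R} (hK : IsBase K) :
    ReflTransGen StepLB (app (cbvEnc M) K) (colon M K) :=
  (reflTransGen_cbvEnc_colon_aux M).1 K hK

theorem reflTransGen_cbvEnc_argCont (M N K : Term R) :
    ReflTransGen StepLB (app (cbvEnc M) (argCont N K)) (colon (app M N) K) :=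
  (reflTransGen_cbvEnc_colon_aux M).2 N (fun _ => reflTransGen_cbvEnc_colon N) K

theorem StepL.colon_aux {M M' : Term R} (h : StepL M M') :
    (∀ K, ReflTransGen StepL (colon M K) (colon M' K)) ∧
    ∀ N K, ReflTransGen StepL (colon (app M N) K) (colon (app M' N) K) := by
  induction h with
  | assocL | assocR | comm | factor | factor1 | factor11 | mulMul | mulDist | oneSmul | zeroSmul
  | smulZero | zeroAdd =>
    constructor <;> intros <;> simp only [colon] <;> exact .single (by constructor)
  | appAddV | appSmulV | appZeroV =>
    constructor <;> intros <;> simp only [colon, colon_app_app] <;> exact .refl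
  | appAddB _ _ hB | appSmulB _ _ hB | appZeroB hB =>
    constructor <;> intros <;> simp only [colon, colon_app_app, colon_app_base hB] <;> exact .refl
  | ctxAppL N _ ih =>
    refine ⟨ih.2 N, fun L K => ?_⟩
    simp only [colon_app_app]
    exact ih.2 N _
  | ctxAddL N _ ih =>
    refine ⟨fun K => ?_, fun L K => ?_⟩ <;> simp only [colon]
    · exact reflTransGen_add (ih.1 K) .refl
    · exact reflTransGen_add (ih.2 L K) .refl
  | ctxAddR N _ ih =>
    refine ⟨fun K => ?_, fun L K => ?_⟩ <;> simp only [colon]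
    · exact reflTransGen_add .refl (ih.1 K)
    · exact reflTransGen_add .refl (ih.2 L K)
  | ctxSmul a _ ih =>
    refine ⟨fun K => ?_, fun L K => ?_⟩ <;> simp only [colon]
    · exact reflTransGen_smul a (ih.1 K)
    · exact reflTransGen_smul a (ih.2 L K)
  | ctxAppR hV _ ih =>
    have h (K : Term R) := colon_app_value_congr (K := K) (fun _ => .refl)
      reflTransGen_add reflTransGen_smul (fun _ => ih.1 _) hV
    refine ⟨h, fun L K => ?_⟩
    simp only [colon_app_app]
    exact h _

/-- Algebraic steps are simulated by algebraic steps on colon forms. -/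
theorem StepL.colon {M M' : Term R} (h : StepL M M') (K : Term R) :
    ReflTransGen StepL (colon M K) (colon M' K) :=
  h.colon_aux.1 K

theorem reflTransGen_colon_beta (M : Term R) {B K : Term R} (hB : IsBase B) :
    ReflTransGen StepLB (colon (app (lam M) B) K) (app (cbvEnc (subst 0 B M)) K) := by
  rw [colon_app_base (.lam M), colon_base hB, cbvEnc_subst M 0 hB]
  refine .head (stepLB_beta (N := app (app (psi (lam M)) (psi B)) K) hB.psi ?_)
    (.single (.inr (.ctxAppL K (.beta _ hB.psi))))
  simp [subst]

theorem StepBv.colon_aux {M M' : Term R} (h : StepBv M M') :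
    (∀ K, IsBase K → ReflTransGen StepLB (colon M K) (colon M' K)) ∧
    ∀ N K, IsBase K → ReflTransGen StepLB (colon (app M N) K) (colon (app M' N) K) := by
  induction h with
  | beta M hB =>
    refine ⟨fun K hK => (reflTransGen_colon_beta M hB).trans (reflTransGen_cbvEnc_colon _ hK),
      fun N K hK => ?_⟩
    rw [colon_app_app]
    exact (reflTransGen_colon_beta M hB).trans (reflTransGen_cbvEnc_argCont _ N K)
  | ctxAppL N _ ih =>
    refine ⟨ih.2 N, fun L K hK => ?_⟩
    simp only [colon_app_app]
    exact ih.2 N _ (.lam _)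
  | ctxAddL N _ ih =>
    refine ⟨fun K hK => ?_, fun L K hK => ?_⟩ <;> simp only [colon]
    · exact StepLB.reflTransGen_add (ih.1 K hK) .refl
    · exact StepLB.reflTransGen_add (ih.2 L K hK) .refl
  | ctxAddR N _ ih =>
    refine ⟨fun K hK => ?_, fun L K hK => ?_⟩ <;> simp only [colon]
    · exact StepLB.reflTransGen_add .refl (ih.1 K hK)
    · exact StepLB.reflTransGen_add .refl (ih.2 L K hK)
  | ctxSmul a _ ih =>
    refine ⟨fun K hK => ?_, fun L K hK => ?_⟩ <;> simp only [colon]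
    · exact StepLB.reflTransGen_smul a (ih.1 K hK)
    · exact StepLB.reflTransGen_smul a (ih.2 L K hK)
  | ctxAppR hV _ ih =>
    have h (K : Term R) := colon_app_value_congr (K := K) (fun _ => .refl)
      StepLB.reflTransGen_add StepLB.reflTransGen_smul (fun _ => ih.1 _ (.lam _)) hV
    refine ⟨fun K _ => h K, fun L K _ => ?_⟩
    simp only [colon_app_app]
    exact h _

/-- Call-by-value β-steps are simulated on colon forms. -/
theorem StepBv.colon {M M' : Term R} (h : StepBv M M') {K : Term R} (hK : IsBase K) :
    ReflTransGen StepLB (colon M K) (colon M' K) :=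
  h.colon_aux.1 K hK

theorem StepLB.colon {M M' : Term R} (h : StepLB M M') {K : Term R} (hK : IsBase K) :
    ReflTransGen StepLB (colon M K) (colon M' K) :=
  h.elim (fun h => ReflTransGen.mono (fun _ _ => .inl) _ _ (h.colon K)) fun h => h.colon hK

theorem IsValue.reflTransGen_colon_psi {V : Term R} (hV : IsValue V) :
    ReflTransGen StepLB (colon V (lam (var 0))) (psi V) := by
  induction hV with
  | zero => rw [colon]; exact .refl
  | base hB => rw [colon_base hB]; exact .single (stepLB_beta hB.psi (by simp [subst]))
  | smul a _ ih => rw [colon]; exact StepLB.reflTransGen_smul a ih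
  | add _ _ ih₁ ih₂ => rw [colon]; exact StepLB.reflTransGen_add ih₁ ih₂

section Fragment

variable {F : Set (Term R)}

theorem reflTransGen_eqLB_of_stepLB (hF : ∀ M ∈ F, ∀ N, StepLB M N → N ∈ F) {M N : Term R}
    (hM : M ∈ F) (h : ReflTransGen StepLB M N) : N ∈ F ∧ ReflTransGen (EqLB F) M N := by
  induction h with
  | refl => exact ⟨hM, .refl⟩
  | tail _ h ih =>
    have hN := hF _ ih.1 _ h
    exact ⟨hN, ih.2.tail (h.imp (fun h => ⟨ih.1, hN, .inl h⟩) fun h => ⟨ih.1, hN, h⟩)⟩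

theorem reflTransGen_eqLB_symm_of_stepL (hF : ∀ M ∈ F, ∀ N, StepLB M N → N ∈ F) {M N : Term R}
    (hM : M ∈ F) (h : ReflTransGen StepL M N) : N ∈ F ∧ ReflTransGen (EqLB F) N M := by
  induction h with
  | refl => exact ⟨hM, .refl⟩
  | tail _ h ih =>
    have hN := hF _ ih.1 _ (.inl h)
    exact ⟨hN, ih.2.head (.inl ⟨hN, ih.1, .inr h⟩)⟩

theorem EqLB.colon (hF : ∀ M ∈ F, ∀ N, StepLB M N → N ∈ F) {K : Term R} (hK : IsBase K)
    (hFK : ∀ M ∈ F, Term.colon M K ∈ F) {M N : Term R} (h : EqLB F M N) :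
    ReflTransGen (EqLB F) (colon M K) (colon N K) := by
  rcases h with ⟨hM, hN, h | h⟩ | ⟨hM, hN, h⟩
  · exact (reflTransGen_eqLB_of_stepLB hF (hFK M hM) (StepLB.colon (.inl h) hK)).2
  · exact (reflTransGen_eqLB_symm_of_stepL hF (hFK N hN) (h.colon K)).2
  · exact (reflTransGen_eqLB_of_stepLB hF (hFK M hM) (h.colon hK)).2

end Fragment

end Simulation

section Statements

variable [CommRing R]

/-- indifference for the call-by-value-to-call-by-name encoding:
(1) if `M →ℓ∪β* V` with `V` a value then `(M~) λx.x →ℓ∪β* Ψ(V)`;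
(2) for every fragment `F` with `(M~) λx.x ∈ F` for all `M ∈ F`, if `M ∈ F` and
`M (=ℓ∪β^F)* V` with `V` a value then `(M~) λx.x (=ℓ∪β^F)* Ψ(V)`. -/
theorem indifference_cbv :
    (∀ M V : Term R, IsValue V → Relation.ReflTransGen StepLB M V →
      Relation.ReflTransGen StepLB (app (cbvEnc M) (lam (var 0))) (psi V)) ∧
    (∀ F : Set (Term R),
      (∀ M ∈ F, ∀ N, StepLB M N → N ∈ F) →
      (∀ M ∈ F, app (cbvEnc M) (lam (var 0)) ∈ F) →
      ∀ M ∈ F, ∀ V : Term R, IsValue V → Relation.ReflTransGen (EqLB F) M V →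
        Relation.ReflTransGen (EqLB F) (app (cbvEnc M) (lam (var 0))) (psi V)) := by
  have hI : IsBase (lam (var 0) : Term R) := .lam _
  refine ⟨fun M V hV h => ?_, fun F hF hFI M hM V hV h => ?_⟩
  · refine (reflTransGen_cbvEnc_colon M hI).trans (.trans ?_ hV.reflTransGen_colon_psi)
    exact h.lift' (colon · (lam (var 0))) fun _ _ h => h.colon hI
  · have hcolon (N : Term R) (hN : N ∈ F) :=
      reflTransGen_eqLB_of_stepLB hF (hFI N hN) (reflTransGen_cbvEnc_colon N hI)
    have hMV : Relation.ReflTransGen (EqLB F) (colon M (lam (var 0))) (colon V (lam (var 0))) :=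
      h.lift' (colon · (lam (var 0))) fun _ _ h =>
        h.colon hF hI fun N hN => (hcolon N hN).1
    have hVF : V ∈ F := by
      rcases h.cases_tail with rfl | ⟨_, _, ⟨_, hVF, _⟩ | ⟨_, hVF, _⟩⟩
      exacts [hM, hVF, hVF]
    exact (hcolon M hM).2.trans (hMV.trans
      (reflTransGen_eqLB_of_stepLB hF (hcolon V hVF).1 hV.reflTransGen_colon_psi).2)

end Statements

end Term

end AlgLam
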